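/- arXiv:1702.08085 — 3 statements merged into one kernel-verified Lean document; each statement's English description precedes it below -/
import Mathlib

section
/- Let L > 0, γ, δ ∈ ℝ with δ > 0 and γ ≠ 0, let T > 0, and let u : ℝ × [0,T) → ℂ be continuously differentiable in t, twice continuously differentiable in x, 2L-periodic in x, and satisfy i∂ₜu + (1/2)∂ₓ²u + |u|²u = iγu + iδ|u|²u pointwise on ℝ × [0,T). Define M(t) = (e^{-2γt}/(2L)) ∫_{-L}^{L} |u(x,t)|² dx and assume M(0) > 0 and γ > -δ M(0). Then T is finite, with T ≤ (1/(2γ)) log(1 + γ/(δ M(0))). -/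
open MeasureTheory intervalIntegral Set

/-- The Cauchy–Schwarz inequality against the constant function `1` on an interval. -/
lemma sq_intervalIntegral_le {f : ℝ → ℝ} {a b : ℝ} (hab : a < b) (hf : Continuous f) :
    (∫ x in a..b, f x) ^ 2 ≤ (b - a) * ∫ x in a..b, f x ^ 2 := by
  have hba : 0 < b - a := sub_pos.2 hab
  set A := ∫ x in a..b, f x with hA
  set c := A / (b - a) with hc
  have hnonneg : 0 ≤ ∫ x in a..b, (f x - c) ^ 2 :=
    intervalIntegral.integral_nonneg hab.le fun x _ => sq_nonneg _
  have hexpand : ∫ x in a..b, (f x - c) ^ 2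
      = (∫ x in a..b, f x ^ 2) - 2 * c * A + c ^ 2 * (b - a) := by
    have hfun : (fun x => (f x - c) ^ 2) = fun x => (f x ^ 2 - 2 * c * f x) + c ^ 2 := by
      ext x; ring
    rw [hfun, intervalIntegral.integral_add, intervalIntegral.integral_sub,
      intervalIntegral.integral_const_mul, intervalIntegral.integral_const, smul_eq_mul, ← hA]
    · ring
    all_goals exact Continuous.intervalIntegrable (by fun_prop) _ _
  have hcA : c * (b - a) = A := by rw [hc]; field_simp
  rw [hexpand] at hnonneg
  nlinarith [mul_nonneg hba.le hnonneg]

/-- An integral over a compact interval is continuous in the parameter. -/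
lemma continuousOn_parametric_intervalIntegral {F : ℝ → ℝ → ℝ} {a b s : ℝ} (hs : 0 ≤ s)
    (hF : ContinuousOn (fun p : ℝ × ℝ => F p.1 p.2) (univ ×ˢ Icc 0 s)) :
    ContinuousOn (fun t => ∫ x in a..b, F x t) (Icc 0 s) := by
  have hG : Continuous (Function.uncurry fun t x : ℝ => F x (projIcc 0 s hs t)) :=
    hF.comp_continuous (f := fun p : ℝ × ℝ => (p.2, (projIcc 0 s hs p.1 : ℝ)))
      (by fun_prop) fun p => ⟨mem_univ _, (projIcc 0 s hs p.1).2⟩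
  refine (intervalIntegral.continuous_parametric_intervalIntegral_of_continuous' (μ := volume)
    hG a b).continuousOn.congr fun t ht => ?_
  simp only [projIcc_of_mem hs ht]

/-- Differentiation under the integral sign over a compact interval. -/
lemma hasDerivAt_parametric_intervalIntegral {F F' : ℝ → ℝ → ℝ} {a b s t : ℝ}
    (ht : t ∈ Ioo 0 s)
    (hF : ContinuousOn (fun p : ℝ × ℝ => F p.1 p.2) (univ ×ˢ Icc 0 s))
    (hF' : ContinuousOn (fun p : ℝ × ℝ => F' p.1 p.2) (univ ×ˢ Icc 0 s))
    (hderiv : ∀ x, ∀ τ ∈ Ioo 0 s, HasDerivAt (fun r => F x r) (F' x τ) τ) :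
    HasDerivAt (fun τ => ∫ x in a..b, F x τ) (∫ x in a..b, F' x t) t := by
  have hslice : ∀ {G : ℝ → ℝ → ℝ},
      ContinuousOn (fun p : ℝ × ℝ => G p.1 p.2) (univ ×ˢ Icc 0 s) →
      ∀ τ ∈ Icc 0 s, Continuous fun x => G x τ := fun hG τ hτ =>
    hG.comp_continuous (f := fun x : ℝ => (x, τ)) (by fun_prop) fun x => ⟨mem_univ _, hτ⟩
  obtain ⟨C, hC⟩ := ((isCompact_uIcc (a := a) (b := b)).prod
    (isCompact_Icc (a := (0 : ℝ)) (b := s))).exists_bound_of_continuousOn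
      (hF'.mono (prod_mono_left (subset_univ _)))
  have hnhds : Ioo 0 s ∈ nhds t := isOpen_Ioo.mem_nhds ht
  refine (intervalIntegral.hasDerivAt_integral_of_dominated_loc_of_deriv_le
    (F := fun τ x => F x τ) (F' := fun τ x => F' x τ) (bound := fun _ => C)
    hnhds ?_ ?_ ?_ ?_ ?_ ?_).2
  · filter_upwards [hnhds] with τ hτ
    exact (hslice hF τ (Ioo_subset_Icc_self hτ)).aestronglyMeasurable
  · exact (hslice hF t (Ioo_subset_Icc_self ht)).intervalIntegrable _ _
  · exact (hslice hF' t (Ioo_subset_Icc_self ht)).aestronglyMeasurable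
  · exact ae_of_all _ fun x hx τ hτ =>
      hC (x, τ) ⟨uIoc_subset_uIcc hx, Ioo_subset_Icc_self hτ⟩
  · exact intervalIntegrable_const
  · exact ae_of_all _ fun x _ τ hτ => hderiv x τ hτ

/-- A positive solution of `M' ≥ 2δ e^{2γt} M²` on `[0, s]` satisfies
`δ (e^{2γs} - 1) / γ < 1 / M 0`. -/
lemma riccati_bound {M M' : ℝ → ℝ} {γ δ s : ℝ} (hδ : 0 < δ) (hγ : γ ≠ 0) (hs : 0 ≤ s)
    (hM : ContinuousOn M (Icc 0 s)) (hM' : ∀ t ∈ Ioo 0 s, HasDerivAt M (M' t) t)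
    (hineq : ∀ t ∈ Ioo 0 s, 2 * δ * Real.exp (2 * γ * t) * M t ^ 2 ≤ M' t) (hM0 : 0 < M 0) :
    δ * ((Real.exp (2 * γ * s) - 1) / γ) < 1 / M 0 := by
  have hmono : MonotoneOn M (Icc 0 s) := by
    refine monotoneOn_of_hasDerivWithinAt_nonneg (f' := M') (convex_Icc 0 s) hM ?_ ?_ <;>
      rw [interior_Icc] <;> intro t ht
    · exact (hM' t ht).hasDerivWithinAt
    · exact le_trans (by positivity) (hineq t ht)
  have h0 : (0 : ℝ) ∈ Icc 0 s := left_mem_Icc.2 hs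
  have hpos : ∀ t ∈ Icc 0 s, 0 < M t := fun t ht => hM0.trans_le (hmono h0 ht ht.1)
  have hanti : AntitoneOn (fun t => (M t)⁻¹ + δ / γ * Real.exp (2 * γ * t)) (Icc 0 s) := by
    refine antitoneOn_of_hasDerivWithinAt_nonpos
      (f' := fun t => -M' t / M t ^ 2 + δ / γ * (Real.exp (2 * γ * t) * (2 * γ)))
      (convex_Icc 0 s) ?_ ?_ ?_
    · exact (hM.inv₀ fun t ht => (hpos t ht).ne').add (by fun_prop)
    · rw [interior_Icc]
      intro t ht
      have hexp : HasDerivAt (fun t => Real.exp (2 * γ * t))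
          (Real.exp (2 * γ * t) * (2 * γ)) t := by
        simpa using ((hasDerivAt_id t).const_mul (2 * γ)).exp
      exact (((hM' t ht).fun_inv (hpos t (Ioo_subset_Icc_self ht)).ne').add
        (hexp.const_mul (δ / γ))).hasDerivWithinAt
    · rw [interior_Icc]
      intro t ht
      have hMt := hpos t (Ioo_subset_Icc_self ht)
      have hle : 2 * δ * Real.exp (2 * γ * t) ≤ M' t / M t ^ 2 := by
        rw [le_div_iff₀ (by positivity)]
        exact hineq t ht
      have heq : δ / γ * (Real.exp (2 * γ * t) * (2 * γ)) = 2 * δ * Real.exp (2 * γ * t) := by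
        field_simp
      rw [heq, neg_div]
      linarith
  have hle := hanti h0 (right_mem_Icc.2 hs) hs
  have hMs := inv_pos.2 (hpos s (right_mem_Icc.2 hs))
  simp only [mul_zero, Real.exp_zero, mul_one] at hle
  have heq : δ * ((Real.exp (2 * γ * s) - 1) / γ)
      = δ / γ * Real.exp (2 * γ * s) - δ / γ := by ring
  rw [heq, one_div]
  linarith

/-- Solving `δ (e^{2γs} - 1) / γ ≤ 1 / m` for `s`. -/
lemma le_log_of_riccati_bound {γ δ m s : ℝ} (hδ : 0 < δ) (hγ : γ ≠ 0) (hm : 0 < m)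
    (hγm : -δ * m < γ) (h : δ * ((Real.exp (2 * γ * s) - 1) / γ) ≤ 1 / m) :
    s ≤ 1 / (2 * γ) * Real.log (1 + γ / (δ * m)) := by
  have hδm : 0 < δ * m := mul_pos hδ hm
  have hpos : 0 < 1 + γ / (δ * m) := by
    have : -1 < γ / (δ * m) := by
      rw [lt_div_iff₀ hδm]
      linarith
    linarith
  have h' : (Real.exp (2 * γ * s) - 1) / γ ≤ 1 / (δ * m) := by
    rw [le_div_iff₀ hδm]
    rw [le_div_iff₀ hm] at h
    linarith
  have hrw : 1 / (2 * γ) * Real.log (1 + γ / (δ * m))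
      = Real.log (1 + γ / (δ * m)) / (2 * γ) := by ring
  rw [hrw]
  rcases lt_or_gt_of_ne hγ with hneg | hgt
  · rw [le_div_iff_of_neg (by linarith), mul_comm s, Real.log_le_iff_le_exp hpos]
    rw [div_le_iff_of_neg hneg, one_div_mul_eq_div] at h'
    linarith
  · rw [le_div_iff₀ (by linarith), mul_comm s, Real.le_log_iff_exp_le hpos]
    rw [div_le_iff₀ hgt, one_div_mul_eq_div] at h'
    linarith

open scoped RealInnerProductSpace in
/-- The pointwise power balance: the dispersive term contributes the `x`-derivative of the flux
`⟪u, i∂ₓu⟫`. -/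
lemma two_mul_inner_of_nls {w wt wxx : ℂ} {γ δ : ℝ}
    (h : Complex.I * wt + (1 / 2 : ℂ) * wxx + (‖w‖ : ℂ) ^ 2 * w
      = Complex.I * (γ : ℂ) * w + Complex.I * (δ : ℂ) * (‖w‖ : ℂ) ^ 2 * w) :
    2 * ⟪w, wt⟫ = ⟪w, Complex.I * wxx⟫ + 2 * γ * ‖w‖ ^ 2 + 2 * δ * (‖w‖ ^ 2) ^ 2 := by
  have hnorm : ‖w‖ ^ 2 = w.re ^ 2 + w.im ^ 2 := by
    rw [← Complex.normSq_eq_norm_sq, Complex.normSq_apply]; ring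
  rw [← Complex.ofReal_pow] at h
  rw [Complex.inner, Complex.inner]
  generalize ‖w‖ ^ 2 = N at h hnorm ⊢
  have hre := congrArg Complex.re h
  have him := congrArg Complex.im h
  simp at hre him
  simp
  linear_combination 2 * w.re * him - 2 * w.im * hre - (2 * γ + 2 * δ * N) * hnorm

open scoped RealInnerProductSpace in
/-- The flux `⟪w, i w'⟫` of a periodic function integrates its derivative to zero over a
period. -/
lemma integral_inner_I_mul_deriv_deriv_eq_zero {w wx wxx : ℝ → ℂ} {L : ℝ}
    (hw : ∀ x, HasDerivAt w (wx x) x) (hwx : ∀ x, HasDerivAt wx (wxx x) x)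
    (hwxx : Continuous wxx) (hper : Function.Periodic w (2 * L)) :
    ∫ x in (-L)..L, ⟪w x, Complex.I * wxx x⟫ = 0 := by
  have hcont : Continuous w := continuous_iff_continuousAt.2 fun x => (hw x).continuousAt
  have hperx : Function.Periodic wx (2 * L) := fun x => by
    have hshift := (hw (x + 2 * L)).comp_add_const x (2 * L)
    rw [funext hper] at hshift
    exact hshift.unique (hw x)
  have hflux : ∀ x, HasDerivAt (fun y => ⟪w y, Complex.I * wx y⟫)
      ⟪w x, Complex.I * wxx x⟫ x := fun x => by
    have hself : ⟪wx x, Complex.I * wx x⟫ = 0 := by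
      rw [Complex.inner]
      simp
      ring
    simpa [hself] using (hw x).inner ℝ ((hwx x).const_mul Complex.I)
  rw [intervalIntegral.integral_eq_sub_of_hasDerivAt (fun x _ => hflux x)
    (Continuous.intervalIntegrable (by fun_prop) _ _)]
  have hL : L = -L + 2 * L := by ring
  have h1 : w L = w (-L) := by conv_lhs => rw [hL, hper]
  have h2 : wx L = wx (-L) := by conv_lhs => rw [hL, hperx]
  rw [h1, h2, sub_self]

/-- **Collapse in finite time, case `γ ≠ 0`.**
For a classical, `2L`-periodic solution of `i∂ₜu + (1/2)∂ₓ²u + |u|²u = iγu + iδ|u|²u`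
on `ℝ × [0,T)` with `δ > 0`, `γ ≠ 0`, if the energy functional
`M(t) = (e^{-2γt}/(2L)) ∫_{-L}^{L} |u|² dx` satisfies `M(0) > 0` and `γ > -δ M(0)`,
then `T` is finite with `T ≤ (1/(2γ)) log(1 + γ/(δ M(0)))`. -/
theorem collapse_time_bound_gamma_ne_zero
    (L γ δ T : ℝ) (hL : 0 < L) (hδ : 0 < δ) (hγ : γ ≠ 0) (hT : 0 < T)
    (u ut ux uxx : ℝ → ℝ → ℂ)
    (hut : ∀ (x : ℝ), ∀ t ∈ Set.Ico (0 : ℝ) T,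
      HasDerivWithinAt (fun τ => u x τ) (ut x t) (Set.Ico (0 : ℝ) T) t)
    (hux : ∀ (x : ℝ), ∀ t ∈ Set.Ico (0 : ℝ) T,
      HasDerivAt (fun y => u y t) (ux x t) x)
    (huxx : ∀ (x : ℝ), ∀ t ∈ Set.Ico (0 : ℝ) T,
      HasDerivAt (fun y => ux y t) (uxx x t) x)
    (hu_cont : ContinuousOn (fun p : ℝ × ℝ => u p.1 p.2) (Set.univ ×ˢ Set.Ico 0 T))
    (hut_cont : ContinuousOn (fun p : ℝ × ℝ => ut p.1 p.2) (Set.univ ×ˢ Set.Ico 0 T))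
    (hux_cont : ContinuousOn (fun p : ℝ × ℝ => ux p.1 p.2) (Set.univ ×ˢ Set.Ico 0 T))
    (huxx_cont : ContinuousOn (fun p : ℝ × ℝ => uxx p.1 p.2) (Set.univ ×ˢ Set.Ico 0 T))
    (hper : ∀ (x t : ℝ), u (x + 2 * L) t = u x t)
    (hpde : ∀ (x : ℝ), ∀ t ∈ Set.Ico (0 : ℝ) T,
      Complex.I * ut x t + (1 / 2 : ℂ) * uxx x t + (‖u x t‖ : ℂ) ^ 2 * u x t
        = Complex.I * (γ : ℂ) * u x t
          + Complex.I * (δ : ℂ) * (‖u x t‖ : ℂ) ^ 2 * u x t)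
    -- the energy functional M
    (M : ℝ → ℝ)
    (hM : ∀ t : ℝ, M t = Real.exp (-2 * γ * t) / (2 * L) * ∫ x in (-L)..L, ‖u x t‖ ^ 2)
    (hM0 : 0 < M 0)
    (hγstar : -δ * M 0 < γ) :
    T ≤ 1 / (2 * γ) * Real.log (1 + γ / (δ * M 0)) := by
  have hbound : ∀ s ∈ Ioo 0 T, s ≤ 1 / (2 * γ) * Real.log (1 + γ / (δ * M 0)) := by
    intro s hs
    have hsub : Icc 0 s ⊆ Ico 0 T := fun t ht => ⟨ht.1, ht.2.trans_lt hs.2⟩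
    have hprod : (univ : Set ℝ) ×ˢ Icc 0 s ⊆ univ ×ˢ Ico 0 T := prod_mono_right hsub
    have hF : ContinuousOn (fun p : ℝ × ℝ => ‖u p.1 p.2‖ ^ 2) (univ ×ˢ Icc 0 s) :=
      (hu_cont.mono hprod).norm.pow 2
    have hF' : ContinuousOn (fun p : ℝ × ℝ => 2 * inner ℝ (u p.1 p.2) (ut p.1 p.2))
        (univ ×ˢ Icc 0 s) :=
      continuousOn_const.mul ((hu_cont.mono hprod).inner (hut_cont.mono hprod))
    have hderiv : ∀ x, ∀ τ ∈ Ioo 0 s,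
        HasDerivAt (fun r => ‖u x r‖ ^ 2) (2 * inner ℝ (u x τ) (ut x τ)) τ := fun x τ hτ =>
      ((hut x τ (hsub (Ioo_subset_Icc_self hτ))).hasDerivAt
        (Ico_mem_nhds hτ.1 (hτ.2.trans hs.2))).norm_sq
    have hbalance : ∀ t ∈ Ioo 0 s, ∫ x in (-L)..L, 2 * inner ℝ (u x t) (ut x t)
        = 2 * γ * (∫ x in (-L)..L, ‖u x t‖ ^ 2)
          + 2 * δ * ∫ x in (-L)..L, (‖u x t‖ ^ 2) ^ 2 := by
      intro t ht
      have htT := hsub (Ioo_subset_Icc_self ht)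
      have hcont : Continuous fun x => u x t :=
        continuous_iff_continuousAt.2 fun x => (hux x t htT).continuousAt
      have hcontxx : Continuous fun x => uxx x t :=
        huxx_cont.comp_continuous (f := fun x : ℝ => (x, t)) (by fun_prop)
          fun x => ⟨mem_univ _, htT⟩
      have hflux := integral_inner_I_mul_deriv_deriv_eq_zero (L := L)
        (fun x => hux x t htT) (fun x => huxx x t htT) hcontxx (fun x => hper x t)
      rw [intervalIntegral.integral_congr fun x _ => two_mul_inner_of_nls (hpde x t htT),
        intervalIntegral.integral_add, intervalIntegral.integral_add, hflux,
        intervalIntegral.integral_const_mul, intervalIntegral.integral_const_mul, zero_add]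
      all_goals exact Continuous.intervalIntegrable (by fun_prop) _ _
    refine le_log_of_riccati_bound hδ hγ hM0 hγstar
      (riccati_bound (M := M) (M' := fun t => Real.exp (-2 * γ * t) / (2 * L)
        * (2 * δ * ∫ x in (-L)..L, (‖u x t‖ ^ 2) ^ 2)) hδ hγ hs.1.le ?_ ?_ ?_ hM0).le
    · rw [funext hM]
      exact ContinuousOn.mul (by fun_prop)
        (continuousOn_parametric_intervalIntegral (F := fun x t => ‖u x t‖ ^ 2) hs.1.le hF)
    · intro t ht
      have hI := hasDerivAt_parametric_intervalIntegral (F := fun x t => ‖u x t‖ ^ 2)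
        (F' := fun x t => 2 * inner ℝ (u x t) (ut x t)) (a := -L) (b := L) ht hF hF' hderiv
      rw [hbalance t ht] at hI
      have hexp : HasDerivAt (fun t => Real.exp (-2 * γ * t) / (2 * L))
          (Real.exp (-2 * γ * t) * (-2 * γ) / (2 * L)) t := by
        simpa using (((hasDerivAt_id t).const_mul (-2 * γ)).exp).div_const (2 * L)
      rw [funext hM]
      exact (hexp.mul hI).congr_deriv (by ring)
    · intro t ht
      have htT := hsub (Ioo_subset_Icc_self ht)
      have hcont : Continuous fun x => u x t :=
        continuous_iff_continuousAt.2 fun x => (hux x t htT).continuousAt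
      have hCS := sq_intervalIntegral_le (f := fun x => ‖u x t‖ ^ 2) (a := -L) (b := L)
        (by linarith) (by fun_prop)
      have hexp : Real.exp (2 * γ * t) * Real.exp (-2 * γ * t) = 1 := by
        rw [← Real.exp_add, ← Real.exp_zero]
        congr 1
        ring
      rw [hM t]
      set A := ∫ x in (-L)..L, ‖u x t‖ ^ 2
      set B := ∫ x in (-L)..L, (‖u x t‖ ^ 2) ^ 2
      set E := Real.exp (-2 * γ * t)
      have hE : 0 < E := Real.exp_pos _
      calc 2 * δ * Real.exp (2 * γ * t) * (E / (2 * L) * A) ^ 2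
          = 2 * δ * E / (2 * L) ^ 2 * (Real.exp (2 * γ * t) * E) * A ^ 2 := by ring
        _ = 2 * δ * E / (2 * L) ^ 2 * A ^ 2 := by rw [hexp, mul_one]
        _ ≤ 2 * δ * E / (2 * L) ^ 2 * ((L - -L) * B) := by gcongr
        _ = E / (2 * L) * (2 * δ * B) := by field_simp; ring
  refine le_of_forall_lt_imp_le_of_dense fun s hsT => ?_
  have hmax : max s (T / 2) ∈ Ioo 0 T :=
    ⟨lt_max_of_lt_right (by linarith), max_lt hsT (by linarith)⟩
  exact (le_max_left _ _).trans (hbound _ hmax)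
end

section
/- Let L > 0, δ > 0, γ = 0, let T > 0, and let u : ℝ × [0,T) → ℂ be continuously differentiable in t, twice continuously differentiable in x, 2L-periodic in x, and satisfy i∂ₜu + (1/2)∂ₓ²u + |u|²u = iδ|u|²u pointwise on ℝ × [0,T). Define M(t) = (1/(2L)) ∫_{-L}^{L} |u(x,t)|² dx and assume M(0) > 0. Then T is finite, with T ≤ 1/(2δ M(0)). -/
open MeasureTheory intervalIntegral Set

/-- A function satisfying the Riccati inequality `F' ≥ c F²` from a positive value cannot exist
past the time `1 / (c F 0)`. -/
theorem riccati_lifespan {F F' : ℝ → ℝ} {b c : ℝ} (hb : 0 ≤ b) (hc : 0 ≤ c)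
    (hF : ContinuousOn F (Icc 0 b)) (hF' : ∀ t ∈ Ioo 0 b, HasDerivAt F (F' t) t)
    (hle : ∀ t ∈ Ioo 0 b, c * F t ^ 2 ≤ F' t) (h0 : 0 < F 0) : c * b * F 0 < 1 := by
  have hmono : MonotoneOn F (Icc 0 b) := by
    refine monotoneOn_of_deriv_nonneg (convex_Icc 0 b) hF ?_ ?_ <;> rw [interior_Icc]
    · exact fun t ht => (hF' t ht).differentiableAt.differentiableWithinAt
    · intro t ht
      rw [(hF' t ht).deriv]
      exact (by positivity : 0 ≤ c * F t ^ 2).trans (hle t ht)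
  have hpos : ∀ t ∈ Icc 0 b, 0 < F t := fun t ht =>
    h0.trans_le (hmono (left_mem_Icc.2 hb) ht ht.1)
  have hderiv : ∀ t ∈ Ioo 0 b,
      HasDerivAt (fun s => (F s)⁻¹ + c * s) (-F' t / F t ^ 2 + c * 1) t := fun t ht =>
    ((hF' t ht).fun_inv (hpos t (Ioo_subset_Icc_self ht)).ne').add
      ((hasDerivAt_id t).const_mul c)
  have hanti : AntitoneOn (fun s => (F s)⁻¹ + c * s) (Icc 0 b) := by
    refine antitoneOn_of_deriv_nonpos (convex_Icc 0 b) ?_ ?_ ?_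
    · exact (hF.inv₀ fun t ht => (hpos t ht).ne').add (by fun_prop)
    all_goals rw [interior_Icc]
    · exact fun t ht => (hderiv t ht).differentiableAt.differentiableWithinAt
    · intro t ht
      have hFt := hpos t (Ioo_subset_Icc_self ht)
      have := (le_div_iff₀ (by positivity)).2 (hle t ht)
      rw [(hderiv t ht).deriv, neg_div]
      linarith
  have h := hanti (left_mem_Icc.2 hb) (right_mem_Icc.2 hb) hb
  have hFb := inv_pos.2 (hpos b (right_mem_Icc.2 hb))
  simp only [mul_zero, add_zero] at h
  have : c * b < (F 0)⁻¹ := by linarith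
  calc c * b * F 0 < (F 0)⁻¹ * F 0 := by gcongr
    _ = 1 := inv_mul_cancel₀ h0.ne'

/-- An integral over a compact interval depends continuously on a parameter in an interval. -/
theorem continuousOn_intervalIntegral_of_continuousOn_prod {f : ℝ → ℝ → ℝ} {a₁ a₂ b : ℝ}
    (hb : 0 ≤ b)
    (hf : ContinuousOn (fun p : ℝ × ℝ => f p.1 p.2) (univ ×ˢ Icc 0 b)) :
    ContinuousOn (fun t => ∫ x in a₁..a₂, f x t) (Icc 0 b) := by
  have hproj : Continuous fun p : ℝ × ℝ => f p.2 (projIcc 0 b hb p.1) :=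
    hf.comp_continuous (f := fun p : ℝ × ℝ => (p.2, (projIcc 0 b hb p.1 : ℝ)))
      (by fun_prop) fun p => ⟨mem_univ _, (projIcc 0 b hb p.1).2⟩
  have hint : Continuous fun t => ∫ x in a₁..a₂, f x (projIcc 0 b hb t) :=
    continuous_parametric_intervalIntegral_of_continuous' hproj a₁ a₂
  refine hint.continuousOn.congr fun t ht => ?_
  simp only [projIcc_of_mem hb ht]

/-- Differentiation under the integral sign for a function with continuous time derivative. -/
theorem hasDerivAt_intervalIntegral_of_continuousOn_prod {f f' : ℝ → ℝ → ℝ} {a₁ a₂ b t : ℝ}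
    (hf : ContinuousOn (fun p : ℝ × ℝ => f p.1 p.2) (univ ×ˢ Icc 0 b))
    (hf' : ContinuousOn (fun p : ℝ × ℝ => f' p.1 p.2) (univ ×ˢ Icc 0 b))
    (hd : ∀ x, ∀ s ∈ Ioo 0 b, HasDerivAt (f x) (f' x s) s) (ht : t ∈ Ioo 0 b) :
    HasDerivAt (fun s => ∫ x in a₁..a₂, f x s) (∫ x in a₁..a₂, f' x t) t := by
  have hslice : ∀ {g : ℝ → ℝ → ℝ},
      ContinuousOn (fun p : ℝ × ℝ => g p.1 p.2) (univ ×ˢ Icc 0 b) →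
      ∀ s ∈ Ioo 0 b, Continuous fun x => g x s := fun hg s hs =>
    hg.comp_continuous (f := fun x => (x, s)) (by fun_prop)
      fun _ => ⟨mem_univ _, Ioo_subset_Icc_self hs⟩
  obtain ⟨C, hC⟩ := (isCompact_uIcc (a := a₁) (b := a₂)).prod (isCompact_Icc (a := 0) (b := b))
    |>.exists_bound_of_continuousOn (hf'.mono (prod_mono_left (subset_univ _)))
  have hnhds : Ioo 0 b ∈ nhds t := isOpen_Ioo.mem_nhds ht
  refine (hasDerivAt_integral_of_dominated_loc_of_deriv_le (F := fun s x => f x s)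
    (F' := fun s x => f' x s) (bound := fun _ => C) hnhds ?_
    ((hslice hf t ht).intervalIntegrable _ _) (hslice hf' t ht).aestronglyMeasurable
    ?_ intervalIntegrable_const ?_).2
  · filter_upwards [hnhds] with s hs using (hslice hf s hs).aestronglyMeasurable
  · exact .of_forall fun x hx s hs =>
      hC (x, s) ⟨uIoc_subset_uIcc hx, Ioo_subset_Icc_self hs⟩
  · exact .of_forall fun x _ s hs => hd x s hs

/-- Integration by parts: `i∂ₓ²` is skew-adjoint on periodic functions. -/
theorem integral_inner_I_mul_deriv_two_eq_zero {v v' v'' : ℝ → ℂ} {L : ℝ}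
    (hv : ∀ x, HasDerivAt v (v' x) x) (hv' : ∀ x, HasDerivAt v' (v'' x) x)
    (hv'' : Continuous v'') (hper : ∀ x, v (x + 2 * L) = v x) :
    ∫ x in (-L)..L, inner ℝ (v x) (Complex.I * v'' x) = 0 := by
  have hper' : ∀ x, v' (x + 2 * L) = v' x := fun x => by
    have h : HasDerivAt (fun y => v (y + 2 * L)) (v' (x + 2 * L)) x :=
      (hv (x + 2 * L)).comp_add_const x (2 * L)
    rw [funext hper] at h
    exact h.unique (hv x)
  have hvc : Continuous v := continuous_iff_continuousAt.2 fun x => (hv x).continuousAt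
  have hderiv : ∀ x, HasDerivAt (fun y => inner ℝ (v y) (Complex.I * v' y))
      (inner ℝ (v x) (Complex.I * v'' x)) x := fun x => by
    refine ((hv x).inner ℝ ((hv' x).const_mul Complex.I)).congr_deriv ?_
    simp only [Complex.inner, Complex.mul_re, Complex.mul_im, Complex.conj_re, Complex.conj_im,
      Complex.I_re, Complex.I_im]
    ring
  rw [integral_eq_sub_of_hasDerivAt (fun x _ => hderiv x)
    ((hvc.inner (continuous_const.mul hv'')).intervalIntegrable _ _)]
  have hL : L = -L + 2 * L := by ring
  have h1 : v L = v (-L) := by rw [← hper (-L), ← hL]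
  have h2 : v' L = v' (-L) := by rw [← hper' (-L), ← hL]
  rw [h1, h2, sub_self]

/-- The Cauchy–Schwarz inequality against constants on `[-L, L]`. -/
theorem sq_average_le_average_sq {g : ℝ → ℝ} (hg : Continuous g) {L : ℝ} (hL : 0 < L) :
    (1 / (2 * L) * ∫ x in (-L)..L, g x) ^ 2 ≤ 1 / (2 * L) * ∫ x in (-L)..L, g x ^ 2 := by
  set m := 1 / (2 * L) * ∫ x in (-L)..L, g x with hm
  have hmean : ∫ x in (-L)..L, g x = 2 * L * m := by rw [hm]; field_simp
  have hnonneg : 0 ≤ ∫ x in (-L)..L, (g x - m) ^ 2 :=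
    integral_nonneg (by linarith) fun _ _ => sq_nonneg _
  have hexpand : ∫ x in (-L)..L, (g x - m) ^ 2
      = (∫ x in (-L)..L, g x ^ 2) - 2 * m * (∫ x in (-L)..L, g x) + 2 * L * m ^ 2 := by
    have h : ∀ x, (g x - m) ^ 2 = g x ^ 2 - 2 * m * g x + m ^ 2 := fun x => by ring
    simp only [h]
    rw [intervalIntegral.integral_add, intervalIntegral.integral_sub,
      intervalIntegral.integral_const_mul, intervalIntegral.integral_const, smul_eq_mul]
    · ring
    all_goals exact Continuous.intervalIntegrable (by fun_prop) _ _
  rw [hexpand, hmean] at hnonneg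
  rw [one_div, inv_mul_eq_div, le_div_iff₀ (by positivity)]
  linarith

/-- The power density balance of the equation, up to the divergence term. -/
theorem inner_eq_of_nls {δ : ℝ} {z zt zxx : ℂ}
    (h : Complex.I * zt + (1 / 2 : ℂ) * zxx + (‖z‖ : ℂ) ^ 2 * z
      = Complex.I * (δ : ℂ) * (‖z‖ : ℂ) ^ 2 * z) :
    2 * inner ℝ z zt = inner ℝ z (Complex.I * zxx) + 2 * δ * (‖z‖ ^ 2) ^ 2 := by
  have hzt : zt = Complex.I * ((1 / 2 : ℝ) * zxx) + Complex.I * ((‖z‖ ^ 2 : ℝ) * z)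
      + (δ * ‖z‖ ^ 2 : ℝ) * z := by
    push_cast
    linear_combination (-Complex.I) * h + (zt - (δ : ℂ) * (‖z‖ : ℂ) ^ 2 * z) * Complex.I_sq
  have hn : ‖z‖ ^ 2 = z.re ^ 2 + z.im ^ 2 := by
    rw [Complex.sq_norm, Complex.normSq_apply]; ring
  rw [hzt, hn]
  simp only [Complex.inner, Complex.mul_re, Complex.mul_im, Complex.conj_re, Complex.conj_im,
    Complex.I_re, Complex.I_im, Complex.add_re, Complex.add_im, Complex.ofReal_re,
    Complex.ofReal_im]
  ring

/-- **Collapse in finite time, case `γ = 0`.**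
For a classical, `2L`-periodic solution of `i∂ₜu + (1/2)∂ₓ²u + |u|²u = iδ|u|²u`
on `ℝ × [0,T)` with `δ > 0`, if the average power
`M(t) = (1/(2L)) ∫_{-L}^{L} |u|² dx` satisfies `M(0) > 0`,
then `T` is finite with `T ≤ 1/(2δ M(0))`. -/
theorem collapse_time_bound_gamma_zero
    (L δ T : ℝ) (hL : 0 < L) (hδ : 0 < δ) (hT : 0 < T)
    (u ut ux uxx : ℝ → ℝ → ℂ)
    (hut : ∀ (x : ℝ), ∀ t ∈ Set.Ico (0 : ℝ) T,
      HasDerivWithinAt (fun τ => u x τ) (ut x t) (Set.Ico (0 : ℝ) T) t)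
    (hux : ∀ (x : ℝ), ∀ t ∈ Set.Ico (0 : ℝ) T,
      HasDerivAt (fun y => u y t) (ux x t) x)
    (huxx : ∀ (x : ℝ), ∀ t ∈ Set.Ico (0 : ℝ) T,
      HasDerivAt (fun y => ux y t) (uxx x t) x)
    (hu_cont : ContinuousOn (fun p : ℝ × ℝ => u p.1 p.2) (Set.univ ×ˢ Set.Ico 0 T))
    (hut_cont : ContinuousOn (fun p : ℝ × ℝ => ut p.1 p.2) (Set.univ ×ˢ Set.Ico 0 T))
    (hux_cont : ContinuousOn (fun p : ℝ × ℝ => ux p.1 p.2) (Set.univ ×ˢ Set.Ico 0 T))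
    (huxx_cont : ContinuousOn (fun p : ℝ × ℝ => uxx p.1 p.2) (Set.univ ×ˢ Set.Ico 0 T))
    (hper : ∀ (x t : ℝ), u (x + 2 * L) t = u x t)
    -- the NLS equation with nonlinear gain and no linear gain/loss (γ = 0)
    (hpde : ∀ (x : ℝ), ∀ t ∈ Set.Ico (0 : ℝ) T,
      Complex.I * ut x t + (1 / 2 : ℂ) * uxx x t + (‖u x t‖ : ℂ) ^ 2 * u x t
        = Complex.I * (δ : ℂ) * (‖u x t‖ : ℂ) ^ 2 * u x t)
    -- the average power M
    (M : ℝ → ℝ)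
    (hM : ∀ t : ℝ, M t = 1 / (2 * L) * ∫ x in (-L)..L, ‖u x t‖ ^ 2)
    (hM0 : 0 < M 0) :
    T ≤ 1 / (2 * δ * M 0) := by
  rw [le_div_iff₀ (by positivity)]
  have hslice : ∀ {g : ℝ → ℝ → ℂ},
      ContinuousOn (fun p : ℝ × ℝ => g p.1 p.2) (univ ×ˢ Ico 0 T) →
      ∀ t ∈ Ico 0 T, Continuous fun x => g x t := fun hg t ht =>
    hg.comp_continuous (f := fun x => (x, t)) (by fun_prop) fun _ => ⟨mem_univ _, ht⟩
  have hbalance : ∀ t ∈ Ico 0 T, 2 * δ * M t ^ 2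
      ≤ 1 / (2 * L) * ∫ x in (-L)..L, 2 * inner ℝ (u x t) (ut x t) := fun t ht => by
    have hu := hslice hu_cont t ht
    have huxx' := hslice huxx_cont t ht
    simp only [fun x => inner_eq_of_nls (hpde x t ht)]
    rw [intervalIntegral.integral_add, intervalIntegral.integral_const_mul,
      integral_inner_I_mul_deriv_two_eq_zero (fun x => hux x t ht) (fun x => huxx x t ht) huxx'
        (fun x => hper x t), zero_add, hM, mul_left_comm]
    · gcongr
      exact sq_average_le_average_sq (hu.norm.pow 2) hL
    all_goals exact Continuous.intervalIntegrable (by fun_prop) _ _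
  have hlife : ∀ b, 0 ≤ b → b < T → 2 * δ * b * M 0 < 1 := fun b hb hbT => by
    have hsub : (univ : Set ℝ) ×ˢ Icc 0 b ⊆ univ ×ˢ Ico 0 T :=
      prod_mono_right (Icc_subset_Ico_right hbT)
    have hIoo : ∀ t ∈ Ioo 0 b, t ∈ Ioo 0 T := fun t ht => ⟨ht.1, ht.2.trans hbT⟩
    have hf : ContinuousOn (fun p : ℝ × ℝ => ‖u p.1 p.2‖ ^ 2) (univ ×ˢ Icc 0 b) :=
      (hu_cont.mono hsub).norm.pow 2
    have hf' : ContinuousOn (fun p : ℝ × ℝ => 2 * inner ℝ (u p.1 p.2) (ut p.1 p.2))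
        (univ ×ˢ Icc 0 b) :=
      continuousOn_const.mul ((hu_cont.mono hsub).inner (hut_cont.mono hsub))
    refine riccati_lifespan hb (by positivity) ?_ (fun t ht => ?_)
      (fun t ht => hbalance t (Ioo_subset_Ico_self (hIoo t ht))) hM0
    · rw [funext hM]
      exact continuousOn_const.mul (continuousOn_intervalIntegral_of_continuousOn_prod
        (f := fun x s => ‖u x s‖ ^ 2) hb hf)
    · rw [funext hM]
      refine (hasDerivAt_intervalIntegral_of_continuousOn_prod (f := fun x s => ‖u x s‖ ^ 2)
        (f' := fun x s => 2 * inner ℝ (u x s) (ut x s)) hf hf' (fun x s hs => ?_) ht).const_mul _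
      have hs' := hIoo s hs
      exact ((hut x s (Ioo_subset_Ico_self hs')).hasDerivAt (Ico_mem_nhds hs'.1 hs'.2)).norm_sq
  by_contra! hlt
  have hK : 0 < 2 * δ * M 0 := by positivity
  have hb : 1 / (2 * δ * M 0) < T := (div_lt_iff₀ hK).2 hlt
  have h := hlife _ (by positivity) hb
  have : 2 * δ * (1 / (2 * δ * M 0)) * M 0 = 1 := by field_simp
  exact absurd h (by rw [this]; exact lt_irrefl 1)
end

section
/- Let γ ≠ 0, δ > 0, T > 0, and let y : [0,T) → ℝ be a differentiable function with y(0) > 0, γ > -δ y(0), satisfying the differential inequality y'(t) ≥ 2δ e^{2γt} y(t)² for all t ∈ [0,T) at which y(t) > 0. If y remains finite on [0,T), then T ≤ (1/(2γ)) log(1 + γ/(δ y(0))). -/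
open Set

/-- A function whose derivative is positive wherever its value equals `y 0` stays above `y 0`. -/
lemma initial_le_of_deriv_pos_at_level {T : ℝ} {y y' : ℝ → ℝ}
    (hderiv : ∀ t ∈ Set.Ico (0 : ℝ) T, HasDerivWithinAt y (y' t) (Set.Ico (0 : ℝ) T) t)
    (hpos : ∀ t ∈ Set.Ico (0 : ℝ) T, y t = y 0 → 0 < y' t)
    {t : ℝ} (ht : t ∈ Set.Ico (0 : ℝ) T) : y 0 ≤ y t := by
  have hsub : ∀ x ∈ Set.Icc 0 t, x ∈ Set.Ico 0 T := fun x hx => ⟨hx.1, hx.2.trans_lt ht.2⟩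
  refine image_le_of_deriv_right_lt_deriv_boundary' (f := fun _ => y 0) (f' := fun _ => 0)
    (a := 0) (b := t) continuousOn_const (fun x _ => hasDerivWithinAt_const x _ _) le_rfl
    (fun x hx => ((hderiv x (hsub x hx)).continuousWithinAt).mono hsub)
    (B' := y') (fun x hx => ?_) (fun x hx h => ?_) ⟨ht.1, le_rfl⟩
  · have hx' := hsub x ⟨hx.1, hx.2.le⟩
    refine ((hderiv x hx').mono (Set.Ico_subset_Ico_left hx'.1)).mono_of_mem_nhdsWithin ?_
    exact Ico_mem_nhdsGE hx'.2
  · exact hpos x (hsub x ⟨hx.1, hx.2.le⟩) h.symm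

/-- Integrated form of the Riccati inequality `y' ≥ 2 δ e^{2γt} y²`. -/
lemma inv_add_exp_le_of_riccati {γ δ T : ℝ} (hγ : γ ≠ 0) {y y' : ℝ → ℝ}
    (hderiv : ∀ t ∈ Set.Ico (0 : ℝ) T, HasDerivWithinAt y (y' t) (Set.Ico (0 : ℝ) T) t)
    (hpos : ∀ t ∈ Set.Ico (0 : ℝ) T, 0 < y t)
    (hineq : ∀ t ∈ Set.Ico (0 : ℝ) T, 2 * δ * Real.exp (2 * γ * t) * (y t) ^ 2 ≤ y' t)
    {t : ℝ} (ht : t ∈ Set.Ico (0 : ℝ) T) :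
    (y t)⁻¹ + δ / γ * Real.exp (2 * γ * t) ≤ (y 0)⁻¹ + δ / γ := by
  have hg : ∀ x ∈ Set.Ico (0 : ℝ) T,
      HasDerivWithinAt (fun s => (y s)⁻¹ + δ / γ * Real.exp (2 * γ * s))
        (-y' x / (y x) ^ 2 + δ / γ * (Real.exp (2 * γ * x) * (2 * γ))) (Set.Ico (0 : ℝ) T) x := by
    intro x hx
    have hexp : HasDerivAt (fun s : ℝ => Real.exp (2 * γ * s))
        (Real.exp (2 * γ * x) * (2 * γ)) x := by
      simpa using ((hasDerivAt_id x).const_mul (2 * γ)).exp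
    exact ((hderiv x hx).fun_inv (hpos x hx).ne').add (hexp.const_mul _).hasDerivWithinAt
  have hanti : AntitoneOn (fun s => (y s)⁻¹ + δ / γ * Real.exp (2 * γ * s)) (Set.Ico 0 T) := by
    refine antitoneOn_of_hasDerivWithinAt_nonpos (convex_Ico 0 T)
      (fun x hx => (hg x hx).continuousWithinAt)
      (fun x hx => (hg x (interior_subset hx)).mono interior_subset) (fun x hx => ?_)
    have hx' := interior_subset hx
    have h : 2 * δ * Real.exp (2 * γ * x) ≤ y' x / (y x) ^ 2 :=
      (le_div_iff₀ (pow_pos (hpos x hx') 2)).2 (hineq x hx')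
    have h2 : δ / γ * (Real.exp (2 * γ * x) * (2 * γ)) = 2 * δ * Real.exp (2 * γ * x) := by
      field_simp
    rw [h2, neg_div]
    linarith
  simpa using hanti ⟨le_rfl, ht.1.trans_lt ht.2⟩ ht ht.1

/-- **Riccati-type differential inequality and finite-time blow-up.**
If `y : [0,T) → ℝ` is differentiable with `y(0) > 0`, `γ > -δ y(0)` (`γ ≠ 0`,
`δ > 0`), and satisfies `y'(t) ≥ 2δ e^{2γt} y(t)²` at every `t ∈ [0,T)` where
`y(t) > 0`, then (since `y` remains finite on `[0,T)`)
`T ≤ (1/(2γ)) log(1 + γ/(δ y(0)))`. -/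
theorem riccati_inequality_blowup_time
    (γ δ T : ℝ) (hγ : γ ≠ 0) (hδ : 0 < δ) (hT : 0 < T)
    (y y' : ℝ → ℝ)
    (hderiv : ∀ t ∈ Set.Ico (0 : ℝ) T,
      HasDerivWithinAt y (y' t) (Set.Ico (0 : ℝ) T) t)
    (hy0 : 0 < y 0)
    (hγstar : -δ * y 0 < γ)
    (hineq : ∀ t ∈ Set.Ico (0 : ℝ) T,
      0 < y t → 2 * δ * Real.exp (2 * γ * t) * (y t) ^ 2 ≤ y' t) :
    T ≤ 1 / (2 * γ) * Real.log (1 + γ / (δ * y 0)) := by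
  have hpos : ∀ t ∈ Set.Ico (0 : ℝ) T, 0 < y t := fun t ht =>
    hy0.trans_le <| initial_le_of_deriv_pos_at_level hderiv (fun s hs h => by
      have hs0 : 0 < y s := h ▸ hy0
      exact lt_of_lt_of_le (by positivity) (hineq s hs hs0)) ht
  have hδy : 0 < δ * y 0 := mul_pos hδ hy0
  have harg : 0 < 1 + γ / (δ * y 0) := by
    have : -1 < γ / (δ * y 0) := by
      rw [lt_div_iff₀ hδy]
      linarith
    linarith
  have key : ∀ t ∈ Set.Ico (0 : ℝ) T, t < 1 / (2 * γ) * Real.log (1 + γ / (δ * y 0)) := by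
    intro t ht
    have h := inv_add_exp_le_of_riccati hγ hderiv hpos (fun s hs => hineq s hs (hpos s hs)) ht
    have hlt : (Real.exp (2 * γ * t) - 1) / γ < 1 / (δ * y 0) := by
      have hinv : 0 < (y t)⁻¹ := inv_pos.2 (hpos t ht)
      have h1 : δ * ((Real.exp (2 * γ * t) - 1) / γ) < δ * (1 / (δ * y 0)) := by
        have e1 : δ * ((Real.exp (2 * γ * t) - 1) / γ)
            = δ / γ * Real.exp (2 * γ * t) - δ / γ := by ring
        have e2 : δ * (1 / (δ * y 0)) = (y 0)⁻¹ := by field_simp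
        rw [e1, e2]
        linarith
      exact lt_of_mul_lt_mul_left h1 hδ.le
    rw [one_div_mul_eq_div]
    rcases hγ.lt_or_gt with hneg | hgt
    · rw [div_lt_iff_of_neg hneg, one_div_mul_eq_div] at hlt
      have hlog := (Real.log_lt_iff_lt_exp harg).2 (by linarith : _ < Real.exp (2 * γ * t))
      rw [lt_div_iff_of_neg (by linarith)]
      linarith
    · rw [div_lt_iff₀ hgt, one_div_mul_eq_div] at hlt
      have hlog := (Real.lt_log_iff_exp_lt harg).2 (by linarith : Real.exp (2 * γ * t) < _)
      rw [lt_div_iff₀ (by linarith)]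
      linarith
  exact le_of_forall_lt fun c hc =>
    (le_max_left c 0).trans_lt (key _ ⟨le_max_right c 0, max_lt hc hT⟩)
end
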